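/- arXiv:2408.09238 — 2 statements merged into one kernel-verified Lean document; each statement's English description precedes it below -/
import Mathlib

section
/- Fix φ with 0 < φ < π/2. The function k ↦ F(φ,k)/K(k) is strictly decreasing on the interval (0,1); that is, for all k₁, k₂ with 0 < k₁ < k₂ < 1 one has F(φ,k₂)/K(k₂) < F(φ,k₁)/K(k₁). -/
open Real

lemma ratio_aux_pos {k s : ℝ} (hk0 : 0 < k) (hk : k < 1) (hs1 : s ≤ 1) :
    0 < 1 - k ^ 2 * s := by
  have h : k ^ 2 < 1 := by nlinarith
  have h0 : 0 < k ^ 2 := by positivity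
  nlinarith

lemma ratio_aux_lt {k₁ k₂ s t : ℝ} (hk₁ : 0 < k₁) (hk : k₁ < k₂) (hk₂ : k₂ < 1)
    (hst : s < t) (ht : t ≤ 1) :
    (1 - k₂ ^ 2 * s) ^ (-(1:ℝ)/2) * (1 - k₁ ^ 2 * t) ^ (-(1:ℝ)/2) <
    (1 - k₂ ^ 2 * t) ^ (-(1:ℝ)/2) * (1 - k₁ ^ 2 * s) ^ (-(1:ℝ)/2) := by
  have a := ratio_aux_pos (hk₁.trans hk) hk₂ (hst.le.trans ht)
  have b := ratio_aux_pos (hk₁.trans hk) hk₂ ht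
  have c := ratio_aux_pos hk₁ (hk.trans hk₂) (hst.le.trans ht)
  have d := ratio_aux_pos hk₁ (hk.trans hk₂) ht
  rw [← mul_rpow a.le d.le, ← mul_rpow b.le c.le]
  apply rpow_lt_rpow_of_neg (mul_pos b c) _ (by norm_num)
  have h : 0 < k₂ ^ 2 - k₁ ^ 2 := by nlinarith
  nlinarith [mul_pos h (sub_pos.2 hst)]

lemma ratio_aux_cont {k : ℝ} (hk0 : 0 < k) (hk : k < 1) :
    Continuous fun ψ : ℝ => (1 - k ^ 2 * sin ψ ^ 2) ^ (-(1:ℝ)/2) := by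
  refine Continuous.rpow_const (by fun_prop) fun x => Or.inl ?_
  exact ne_of_gt (ratio_aux_pos hk0 hk (sin_sq_le_one x))

/-- The ratio `F(φ,k)/K(k)` of the incomplete to the complete elliptic integral of the
first kind is strictly decreasing in the modulus `k` on `(0,1)`, for fixed `0 < φ < π/2`. -/
theorem ratio_elliptic_integral_strictAnti
    (φ : ℝ) (hφ₀ : 0 < φ) (hφ₁ : φ < π / 2)
    (k₁ k₂ : ℝ) (hk₁ : 0 < k₁) (hk : k₁ < k₂) (hk₂ : k₂ < 1) :
    (∫ ψ in (0:ℝ)..φ, (1 - k₂ ^ 2 * sin ψ ^ 2) ^ (-(1:ℝ)/2)) /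
      (∫ ψ in (0:ℝ)..(π/2), (1 - k₂ ^ 2 * sin ψ ^ 2) ^ (-(1:ℝ)/2)) <
    (∫ ψ in (0:ℝ)..φ, (1 - k₁ ^ 2 * sin ψ ^ 2) ^ (-(1:ℝ)/2)) /
      (∫ ψ in (0:ℝ)..(π/2), (1 - k₁ ^ 2 * sin ψ ^ 2) ^ (-(1:ℝ)/2)) := by
  have hk20 := hk₁.trans hk
  have hk11 := hk.trans hk₂
  have c1 := ratio_aux_cont hk₁ hk11
  have c2 := ratio_aux_cont hk20 hk₂
  have p1 : ∀ x : ℝ, 0 < (1 - k₁ ^ 2 * sin x ^ 2) ^ (-(1:ℝ)/2) := fun x =>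
    rpow_pos_of_pos (ratio_aux_pos hk₁ hk11 (sin_sq_le_one x)) _
  have p2 : ∀ x : ℝ, 0 < (1 - k₂ ^ 2 * sin x ^ 2) ^ (-(1:ℝ)/2) := fun x =>
    rpow_pos_of_pos (ratio_aux_pos hk20 hk₂ (sin_sq_le_one x)) _
  have key : ∀ x y : ℝ, 0 ≤ x → x < y → y ≤ π / 2 →
      (1 - k₂ ^ 2 * sin x ^ 2) ^ (-(1:ℝ)/2) * (1 - k₁ ^ 2 * sin y ^ 2) ^ (-(1:ℝ)/2) <
      (1 - k₂ ^ 2 * sin y ^ 2) ^ (-(1:ℝ)/2) * (1 - k₁ ^ 2 * sin x ^ 2) ^ (-(1:ℝ)/2) := by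
    intro x y hx hxy hy
    refine ratio_aux_lt hk₁ hk hk₂ ?_ (sin_sq_le_one y)
    have h1 : sin x < sin y := sin_lt_sin_of_lt_of_le_pi_div_two (by linarith) hy hxy
    have h0 : 0 ≤ sin x := sin_nonneg_of_nonneg_of_le_pi hx (by linarith)
    nlinarith
  generalize hf : (fun x : ℝ => (1 - k₁ ^ 2 * sin x ^ 2) ^ (-(1:ℝ)/2)) = f at *
  generalize hg : (fun x : ℝ => (1 - k₂ ^ 2 * sin x ^ 2) ^ (-(1:ℝ)/2)) = g at *
  have hf' : ∀ x : ℝ, (1 - k₁ ^ 2 * sin x ^ 2) ^ (-(1:ℝ)/2) = f x := fun x => by rw [← hf]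
  have hg' : ∀ x : ℝ, (1 - k₂ ^ 2 * sin x ^ 2) ^ (-(1:ℝ)/2) = g x := fun x => by rw [← hg]
  simp only [hf', hg'] at *
  have i1 : ∀ a b, IntervalIntegrable f MeasureTheory.volume a b := fun a b =>
    c1.intervalIntegrable a b
  have i2 : ∀ a b, IntervalIntegrable g MeasureTheory.volume a b := fun a b =>
    c2.intervalIntegrable a b
  rw [← intervalIntegral.integral_add_adjacent_intervals (i1 0 φ) (i1 φ (π/2)),
    ← intervalIntegral.integral_add_adjacent_intervals (i2 0 φ) (i2 φ (π/2))]
  have A1 : 0 < ∫ x in (0:ℝ)..φ, f x :=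
    intervalIntegral.intervalIntegral_pos_of_pos (i1 _ _) p1 hφ₀
  have A2 : 0 < ∫ x in (0:ℝ)..φ, g x :=
    intervalIntegral.intervalIntegral_pos_of_pos (i2 _ _) p2 hφ₀
  have B1 : 0 < ∫ x in φ..(π/2), f x :=
    intervalIntegral.intervalIntegral_pos_of_pos (i1 _ _) p1 hφ₁
  have B2 : 0 < ∫ x in φ..(π/2), g x :=
    intervalIntegral.intervalIntegral_pos_of_pos (i2 _ _) p2 hφ₁
  have hA : (∫ x in (0:ℝ)..φ, g x) * f φ < g φ * ∫ x in (0:ℝ)..φ, f x := by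
    rw [← intervalIntegral.integral_mul_const, ← intervalIntegral.integral_const_mul]
    refine intervalIntegral.integral_lt_integral_of_continuousOn_of_le_of_exists_lt hφ₀
      (by fun_prop) (by fun_prop) ?_ ⟨0, ⟨le_rfl, hφ₀.le⟩, key 0 φ le_rfl hφ₀ hφ₁.le⟩
    intro x hx
    rcases hx.2.eq_or_lt with h | h
    · rw [h]
    · exact (key x φ hx.1.le h hφ₁.le).le
  have hB : g φ * (∫ x in φ..(π/2), f x) ≤ (∫ x in φ..(π/2), g x) * f φ := by
    rw [← intervalIntegral.integral_mul_const, ← intervalIntegral.integral_const_mul]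
    refine intervalIntegral.integral_mono_on hφ₁.le ((i1 _ _).const_mul _)
      ((i2 _ _).mul_const _) ?_
    intro x hx
    rcases hx.1.eq_or_lt with h | h
    · rw [h]
    · exact (key φ x hφ₀.le h hx.2).le
  generalize (∫ x in (0:ℝ)..φ, f x) = a1 at *
  generalize (∫ x in (0:ℝ)..φ, g x) = a2 at *
  generalize (∫ x in φ..(π/2), f x) = b1 at *
  generalize (∫ x in φ..(π/2), g x) = b2 at *
  have h : a2 * b1 < a1 * b2 := by
    have h1 := mul_lt_mul_of_pos_right hA B1
    have h2 := mul_le_mul_of_nonneg_left hB A1.le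
    refine lt_of_mul_lt_mul_left (a := f φ) ?_ (p1 φ).le
    linarith
  rw [div_lt_div_iff₀ (by positivity) (by positivity)]
  linarith
end

section
/- Let a < c < b be real numbers, let w : [a,b] → ℝ be continuous and strictly positive, and let g : [a,b] → ℝ be continuous and strictly increasing. Then (∫_a^c g(ψ)·w(ψ) dψ) · (∫_c^b w(ψ) dψ) < (∫_a^c w(ψ) dψ) · (∫_c^b g(ψ)·w(ψ) dψ). -/
open Real

/-- Cross-interval Chebyshev-type inequality: if `w > 0` is continuous and `g` is
continuous and strictly increasing on `[a,b]`, and `a < c < b`, then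
`(∫_a^c g w)(∫_c^b w) < (∫_a^c w)(∫_c^b g w)`. -/
theorem cross_chebyshev_inequality
    (a b c : ℝ) (hac : a < c) (hcb : c < b)
    (w g : ℝ → ℝ)
    (hw : ContinuousOn w (Set.Icc a b)) (hwpos : ∀ x ∈ Set.Icc a b, 0 < w x)
    (hg : ContinuousOn g (Set.Icc a b)) (hgmono : StrictMonoOn g (Set.Icc a b)) :
    (∫ ψ in a..c, g ψ * w ψ) * (∫ ψ in c..b, w ψ) <
      (∫ ψ in a..c, w ψ) * (∫ ψ in c..b, g ψ * w ψ) := by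
  have s1 : Set.Icc a c ⊆ Set.Icc a b := Set.Icc_subset_Icc le_rfl hcb.le
  have s2 : Set.Icc c b ⊆ Set.Icc a b := Set.Icc_subset_Icc hac.le le_rfl
  have hc : c ∈ Set.Icc a b := ⟨hac.le, hcb.le⟩
  have ha : a ∈ Set.Icc a b := ⟨le_rfl, (hac.trans hcb).le⟩
  have hb : b ∈ Set.Icc a b := ⟨(hac.trans hcb).le, le_rfl⟩
  have p1 : 0 < ∫ ψ in a..c, w ψ :=
    intervalIntegral.intervalIntegral_pos_of_pos_on
      ((hw.mono s1).intervalIntegrable_of_Icc hac.le)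
      (fun x hx => hwpos x (s1 ⟨hx.1.le, hx.2.le⟩)) hac
  have p2 : 0 < ∫ ψ in c..b, w ψ :=
    intervalIntegral.intervalIntegral_pos_of_pos_on
      ((hw.mono s2).intervalIntegrable_of_Icc hcb.le)
      (fun x hx => hwpos x (s2 ⟨hx.1.le, hx.2.le⟩)) hcb
  have i1 : (∫ ψ in a..c, g ψ * w ψ) < ∫ ψ in a..c, g c * w ψ := by
    apply intervalIntegral.integral_lt_integral_of_continuousOn_of_le_of_exists_lt hac
      ((hg.mono s1).mul (hw.mono s1)) (continuousOn_const.mul (hw.mono s1))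
    · intro x hx
      have hx' : x ∈ Set.Icc a b := s1 ⟨hx.1.le, hx.2⟩
      exact mul_le_mul_of_nonneg_right (hgmono.monotoneOn hx' hc hx.2) (hwpos x hx').le
    · exact ⟨a, ⟨le_rfl, hac.le⟩, mul_lt_mul_of_pos_right (hgmono ha hc hac) (hwpos a ha)⟩
  have i2 : (∫ ψ in c..b, g c * w ψ) < ∫ ψ in c..b, g ψ * w ψ := by
    apply intervalIntegral.integral_lt_integral_of_continuousOn_of_le_of_exists_lt hcb
      (continuousOn_const.mul (hw.mono s2)) ((hg.mono s2).mul (hw.mono s2))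
    · intro x hx
      have hx' : x ∈ Set.Icc a b := s2 ⟨hx.1.le, hx.2⟩
      exact mul_le_mul_of_nonneg_right (hgmono.monotoneOn hc hx' hx.1.le) (hwpos x hx').le
    · exact ⟨b, ⟨hcb.le, le_rfl⟩, mul_lt_mul_of_pos_right (hgmono hc hb hcb) (hwpos b hb)⟩
  rw [intervalIntegral.integral_const_mul] at i1 i2
  have j1 := mul_lt_mul_of_pos_right i1 p2
  have j2 := mul_lt_mul_of_pos_left i2 p1
  linarith
end
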